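/- arXiv:cond-mat/9908326 — 2 statements merged into one kernel-verified Lean document; each statement's English description precedes it below -/
import Mathlib

section
/- The R-matrix and L-operator of the XYZ chain satisfy the local Yang–Baxter equation: for all spectral parameters λ, μ ∈ ℂ and each site n, R(λ,μ)·(L_n(λ) ⊗ L_n(μ)) = (L_n(μ) ⊗ L_n(λ))·R(λ,μ), as an identity of 4×4 matrices whose entries are operators on the site Hilbert space ℂ² (equivalently an identity of 8×8 complex matrices after taking the Kronecker product with the site space). -/
open Complex Matrix Finset
open scoped Kronecker

noncomputable section

/-- Jacobi theta function `θ₁(z|τ) = -i ∑_{n∈ℤ} (-1)^n exp(πi(n+1/2)²τ + (2n+1)iz)`. -/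
def theta1 (z τ : ℂ) : ℂ :=
  ∑' n : ℤ, -Complex.I * (-1 : ℂ) ^ n *
    Complex.exp ((Real.pi : ℂ) * Complex.I * ((n : ℂ) + 1 / 2) ^ 2 * τ +
      (2 * (n : ℂ) + 1) * Complex.I * z)

/-- Jacobi theta function `θ₄(z|τ) = ∑_{n∈ℤ} (-1)^n exp(πin²τ + 2inz)`. -/
def theta4 (z τ : ℂ) : ℂ :=
  ∑' n : ℤ, (-1 : ℂ) ^ n *
    Complex.exp ((Real.pi : ℂ) * Complex.I * (n : ℂ) ^ 2 * τ +
      2 * (n : ℂ) * Complex.I * z)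

/-- `H(μ) = θ₁(πμ/2K | iK'/K)`, the Jacobi theta function with quasi-periods 2K, 2iK'. -/
def HJ (K K' μ : ℂ) : ℂ := theta1 ((Real.pi : ℂ) * μ / (2 * K)) (Complex.I * K' / K)

/-- `Θ(μ) = θ₄(πμ/2K | iK'/K)`. -/
def ΘJ (K K' μ : ℂ) : ℂ := theta4 ((Real.pi : ℂ) * μ / (2 * K)) (Complex.I * K' / K)

/-- `g(μ) = H(μ)Θ(μ)`. -/
def gJ (K K' μ : ℂ) : ℂ := HJ K K' μ * ΘJ K K' μ

/-- `h(μ) = g(μ)Θ(0)`. -/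
def hJ (K K' μ : ℂ) : ℂ := gJ K K' μ * ΘJ K K' 0

/-- `τ_k = (s+t)/2 + 2kη − K`. -/
def τJ (K η s t : ℂ) (k : ℤ) : ℂ := (s + t) / 2 + 2 * (k : ℂ) * η - K

/-- `α(λ,μ) = h(λ−μ−2η)/h(λ−μ)`. -/
def αJ (K K' η lam mu : ℂ) : ℂ := hJ K K' (lam - mu - 2 * η) / hJ K K' (lam - mu)

/-- `β_k(λ,μ) = (h(2η)/h(μ−λ))·(h(τ_k+μ−λ)/h(τ_k))`. -/
def βJ (K K' η s t : ℂ) (k : ℤ) (lam mu : ℂ) : ℂ :=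
  hJ K K' (2 * η) / hJ K K' (mu - lam) *
    (hJ K K' (τJ K η s t k + mu - lam) / hJ K K' (τJ K η s t k))

/-- Pauli matrices. -/
def σx : Matrix (Fin 2) (Fin 2) ℂ := !![0, 1; 1, 0]
def σy : Matrix (Fin 2) (Fin 2) ℂ := !![0, -Complex.I; Complex.I, 0]
def σz : Matrix (Fin 2) (Fin 2) ℂ := !![1, 0; 0, -1]

/-- `w₄+w₃ = Θ(2η)Θ(μ−η)H(μ+η)` etc. -/
def w4p3 (K K' η μ : ℂ) : ℂ := ΘJ K K' (2 * η) * ΘJ K K' (μ - η) * HJ K K' (μ + η)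
def w4m3 (K K' η μ : ℂ) : ℂ := ΘJ K K' (2 * η) * HJ K K' (μ - η) * ΘJ K K' (μ + η)
def w1p2 (K K' η μ : ℂ) : ℂ := HJ K K' (2 * η) * ΘJ K K' (μ - η) * ΘJ K K' (μ + η)
def w1m2 (K K' η μ : ℂ) : ℂ := HJ K K' (2 * η) * HJ K K' (μ - η) * HJ K K' (μ + η)
def wc4 (K K' η μ : ℂ) : ℂ := (w4p3 K K' η μ + w4m3 K K' η μ) / 2
def wc3 (K K' η μ : ℂ) : ℂ := (w4p3 K K' η μ - w4m3 K K' η μ) / 2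
def wc1 (K K' η μ : ℂ) : ℂ := (w1p2 K K' η μ + w1m2 K K' η μ) / 2
def wc2 (K K' η μ : ℂ) : ℂ := (w1p2 K K' η μ - w1m2 K K' η μ) / 2

/-- The single-site `L`-operator, a 2×2 matrix in auxiliary space whose entries are
operators (2×2 matrices) on the site Hilbert space ℂ². -/
def Lsite (K K' η μ : ℂ) : Matrix (Fin 2) (Fin 2) (Matrix (Fin 2) (Fin 2) ℂ) :=
  !![wc4 K K' η μ • (1 : Matrix (Fin 2) (Fin 2) ℂ) + wc3 K K' η μ • σz,
      wc1 K K' η μ • σx - (Complex.I * wc2 K K' η μ) • σy;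
      wc1 K K' η μ • σx + (Complex.I * wc2 K K' η μ) • σy,
      wc4 K K' η μ • (1 : Matrix (Fin 2) (Fin 2) ℂ) - wc3 K K' η μ • σz]

/-- Entries of the R-matrix. -/
def aJ (K K' η lam mu : ℂ) : ℂ := ΘJ K K' (2*η) * ΘJ K K' (lam - mu) * HJ K K' (lam - mu + 2*η)
def bJ (K K' η lam mu : ℂ) : ℂ := HJ K K' (2*η) * ΘJ K K' (lam - mu) * ΘJ K K' (lam - mu + 2*η)
def cJ (K K' η lam mu : ℂ) : ℂ := ΘJ K K' (2*η) * HJ K K' (lam - mu) * ΘJ K K' (lam - mu + 2*η)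
def dJ (K K' η lam mu : ℂ) : ℂ := HJ K K' (2*η) * HJ K K' (lam - mu) * HJ K K' (lam - mu + 2*η)

/-- The 4×4 R-matrix, with rows/columns indexed by `Fin 2 × Fin 2`
(the basis order (0,0),(0,1),(1,0),(1,1) corresponds to rows 1,2,3,4):
nonzero entries R₁₁ = R₄₄ = a, R₂₂ = R₃₃ = b, R₂₃ = R₃₂ = c, R₁₄ = R₄₁ = d. -/
def Rc (K K' η lam mu : ℂ) : Matrix (Fin 2 × Fin 2) (Fin 2 × Fin 2) ℂ :=
  Matrix.of fun p q =>
    if p = q then (if p.1 = p.2 then aJ K K' η lam mu else bJ K K' η lam mu)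
    else if q = (p.2, p.1) ∧ p.1 ≠ p.2 then cJ K K' η lam mu
    else if p.1 = p.2 ∧ q.1 = q.2 then dJ K K' η lam mu
    else 0

/-- Spin configurations of a chain of length L: the index set of the basis of (ℂ²)^{⊗L}. -/
abbrev Conf (L : ℕ) := Fin L → Fin 2

/-- Operators on (ℂ²)^{⊗L}. -/
abbrev OpC (L : ℕ) := Matrix (Conf L) (Conf L) ℂ

/-- Embedding of a one-site operator at site `n` of the chain (identity elsewhere). -/
def embed (L : ℕ) (n : Fin L) (A : Matrix (Fin 2) (Fin 2) ℂ) : OpC L :=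
  Matrix.of fun f g => A (f n) (g n) * ∏ m ∈ univ.erase n, if f m = g m then 1 else 0

/-- The `L`-operator at site `n`, entries acting on (ℂ²)^{⊗L}. -/
def Lop (K K' η : ℂ) (L : ℕ) (n : Fin L) (μ : ℂ) : Matrix (Fin 2) (Fin 2) (OpC L) :=
  (Lsite K K' η μ).map (embed L n)

/-- The monodromy matrix `T(μ) = L_L(μ)···L_1(μ)` (site n = i+1 for `i : Fin L`). -/
def Tm (K K' η : ℂ) (L : ℕ) (μ : ℂ) : Matrix (Fin 2) (Fin 2) (OpC L) :=
  (List.ofFn fun i : Fin L => Lop K K' η L i.rev μ).prod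

def Amat (K K' η : ℂ) (L : ℕ) (μ : ℂ) : OpC L := Tm K K' η L μ 0 0
def Bmat (K K' η : ℂ) (L : ℕ) (μ : ℂ) : OpC L := Tm K K' η L μ 0 1
def Cmat (K K' η : ℂ) (L : ℕ) (μ : ℂ) : OpC L := Tm K K' η L μ 1 0
def Dmat (K K' η : ℂ) (L : ℕ) (μ : ℂ) : OpC L := Tm K K' η L μ 1 1

/-- The gauge matrix `M_k(μ)`. -/
def Mg (K K' η s t : ℂ) (k : ℤ) (μ : ℂ) : Matrix (Fin 2) (Fin 2) ℂ :=
  !![HJ K K' (s + 2 * (k : ℂ) * η - μ), (gJ K K' (τJ K η s t k))⁻¹ * HJ K K' (t + 2 * (k : ℂ) * η + μ);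
     ΘJ K K' (s + 2 * (k : ℂ) * η - μ), (gJ K K' (τJ K η s t k))⁻¹ * ΘJ K K' (t + 2 * (k : ℂ) * η + μ)]

/-- View a scalar 2×2 matrix as a 2×2 matrix of operators on (ℂ²)^{⊗L}. -/
def toOp (L : ℕ) (A : Matrix (Fin 2) (Fin 2) ℂ) : Matrix (Fin 2) (Fin 2) (OpC L) :=
  A.map fun z => z • (1 : OpC L)

/-- View a scalar 2×2 matrix as a 2×2 matrix of one-site operators. -/
def toOp2 (A : Matrix (Fin 2) (Fin 2) ℂ) : Matrix (Fin 2) (Fin 2) (Matrix (Fin 2) (Fin 2) ℂ) :=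
  A.map fun z => z • (1 : Matrix (Fin 2) (Fin 2) ℂ)

/-- The gauge-transformed monodromy matrix `T_{k,l}(μ) = M_k(μ)⁻¹ T(μ) M_l(μ)`. -/
def Tg (K K' η s t : ℂ) (L : ℕ) (k l : ℤ) (μ : ℂ) : Matrix (Fin 2) (Fin 2) (OpC L) :=
  toOp L (Mg K K' η s t k μ)⁻¹ * Tm K K' η L μ * toOp L (Mg K K' η s t l μ)

def Ag (K K' η s t : ℂ) (L : ℕ) (k l : ℤ) (μ : ℂ) : OpC L := Tg K K' η s t L k l μ 0 0
def Bg (K K' η s t : ℂ) (L : ℕ) (k l : ℤ) (μ : ℂ) : OpC L := Tg K K' η s t L k l μ 0 1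
def Cg (K K' η s t : ℂ) (L : ℕ) (k l : ℤ) (μ : ℂ) : OpC L := Tg K K' η s t L k l μ 1 0
def Dg (K K' η s t : ℂ) (L : ℕ) (k l : ℤ) (μ : ℂ) : OpC L := Tg K K' η s t L k l μ 1 1

/-- The gauge-transformed one-site L-operator `L_n^l(μ) = M_{n+l}(μ)⁻¹ L_n(μ) M_{n+l−1}(μ)`. -/
def Lg (K K' η s t : ℂ) (n l : ℤ) (μ : ℂ) : Matrix (Fin 2) (Fin 2) (Matrix (Fin 2) (Fin 2) ℂ) :=
  toOp2 (Mg K K' η s t (n + l) μ)⁻¹ * Lsite K K' η μ * toOp2 (Mg K K' η s t (n + l - 1) μ)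

/-- The local vacuum `|ω_n^l⟩` (depending on n, l only through nl = n + l):
`H(s+(2(n+l)−1)η)|↑⟩ + Θ(s+(2(n+l)−1)η)|↓⟩`. -/
def ωvec (K K' η s : ℂ) (nl : ℤ) : Fin 2 → ℂ :=
  ![HJ K K' (s + (2 * (nl : ℂ) - 1) * η), ΘJ K K' (s + (2 * (nl : ℂ) - 1) * η)]

/-- The dual local vacuum `⟨ω_n^l| = Θ(t+(2(n+l)−1)η)⟨↑| − H(t+(2(n+l)−1)η)⟨↓|`. -/
def ωdual (K K' η t : ℂ) (nl : ℤ) : Fin 2 → ℂ :=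
  ![ΘJ K K' (t + (2 * (nl : ℂ) - 1) * η), -HJ K K' (t + (2 * (nl : ℂ) - 1) * η)]

/-- The generating vector `|l⟩ = |ω_L^l⟩⊗···⊗|ω_1^l⟩` (site n = i+1). -/
def genV (K K' η s : ℂ) (L : ℕ) (l : ℤ) : Conf L → ℂ :=
  fun f => ∏ i : Fin L, ωvec K K' η s ((i : ℕ) + 1 + l) (f i)

/-- The dual generating vector `⟨l| = ⟨ω_1^l|⊗···⊗⟨ω_L^l|`. -/
def genD (K K' η t : ℂ) (L : ℕ) (l : ℤ) : Conf L → ℂ :=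
  fun f => ∏ i : Fin L, ωdual K K' η t ((i : ℕ) + 1 + l) (f i)

/-- The n-particle Bethe vector
`|Ψ_l^n(λ₁,…,λ_n)⟩ = B_{l+N−n+1,l−N+n−1}(λ₁)···B_{l+N,l−N}(λ_n)|l−N⟩`
(for n = N this is `|Ψ_l(λ₁,…,λ_N)⟩ = B_{l+1,l−1}(λ₁)···B_{l+N,l−N}(λ_N)|l−N⟩`). -/
def psiB (K K' η s t : ℂ) (L N n : ℕ) (l : ℤ) (lam : Fin n → ℂ) : Conf L → ℂ :=
  ((List.ofFn fun j : Fin n =>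
      Bg K K' η s t L (l + (N : ℤ) - (n : ℤ) + 1 + (j : ℕ)) (l - (N : ℤ) + (n : ℤ) - 1 - (j : ℕ))
        (lam j)).prod).mulVec
    (genV K K' η s L (l - (N : ℤ)))

/-- The dual n-particle Bethe vector
`⟨Ψ_l^n(λ₁,…,λ_n)| = ⟨l−N+1| C_{l+N−1,l−N+1}(λ_n)···C_{l+N−n,l−N+n}(λ₁)`. -/
def psiC (K K' η s t : ℂ) (L N n : ℕ) (l : ℤ) (lam : Fin n → ℂ) : Conf L → ℂ :=
  Matrix.vecMul (genD K K' η t L (l - (N : ℤ) + 1))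
    ((List.ofFn fun j : Fin n =>
        Cg K K' η s t L (l + (N : ℤ) - 1 - (j : ℕ)) (l - (N : ℤ) + 1 + (j : ℕ))
          (lam j.rev)).prod)

/-- `r(λ) = (h(λ+η)/h(λ−η))^L`. -/
def rJ (K K' η : ℂ) (L : ℕ) (lam : ℂ) : ℂ := (hJ K K' (lam + η) / hJ K K' (lam - η)) ^ L

/-- The eigenvalue `Λ_m(μ;{λ_k})`. -/
def ΛJ (K K' η : ℂ) (L Q m : ℕ) {n : ℕ} (lam : Fin n → ℂ) (μ : ℂ) : ℂ :=
  Complex.exp (2 * (Real.pi : ℂ) * Complex.I * (m : ℂ) / (Q : ℂ)) *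
      ((hJ K K' (μ + η)) ^ L * ∏ k, αJ K K' η μ (lam k)) +
    Complex.exp (-(2 * (Real.pi : ℂ) * Complex.I * (m : ℂ) / (Q : ℂ))) *
      ((hJ K K' (μ - η)) ^ L * ∏ k, αJ K K' η (lam k) μ)

/-- The sum of norms of the Bethe vectors
`M_n(λ₁,…,λ_n) = (1/Q) Σ_{l=0}^{Q−1} ⟨Ψ_l^n(λ)|Ψ_l^n(λ)⟩`. -/
def MnS (K K' η s t : ℂ) (Q L N n : ℕ) (lam : Fin n → ℂ) : ℂ :=
  (Q : ℂ)⁻¹ * ∑ l ∈ Finset.range Q,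
    dotProduct (psiC K K' η s t L N n (l : ℤ) lam) (psiB K K' η s t L N n (l : ℤ) lam)

/-- `c_L = ⟨l|l−1⟩` (evaluated at l = 0, being independent of l). -/
def cLJ (K K' η s t : ℂ) (L : ℕ) : ℂ :=
  dotProduct (genD K K' η t L 0) (genV K K' η s L (-1))

/-- The eigenvector `|Φ_m⟩ = (1/√Q) Σ_{l=0}^{Q−1} e^{2πilm/Q} |Ψ_l⟩`. -/
def PhiV (K K' η s t : ℂ) (Q L N m : ℕ) (lam : Fin N → ℂ) : Conf L → ℂ :=
  ((Real.sqrt Q : ℝ) : ℂ)⁻¹ • ∑ l ∈ Finset.range Q,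
    Complex.exp (2 * (Real.pi : ℂ) * Complex.I * (l : ℂ) * (m : ℂ) / (Q : ℂ)) •
      psiB K K' η s t L N N (l : ℤ) lam

/-- The dual eigenvector `⟨Φ_m| = (1/√Q) Σ_{l=0}^{Q−1} e^{−2πilm/Q} ⟨Ψ_l|`. -/
def PhiD (K K' η s t : ℂ) (Q L N m : ℕ) (lam : Fin N → ℂ) : Conf L → ℂ :=
  ((Real.sqrt Q : ℝ) : ℂ)⁻¹ • ∑ l ∈ Finset.range Q,
    Complex.exp (-(2 * (Real.pi : ℂ) * Complex.I * (l : ℂ) * (m : ℂ) / (Q : ℂ))) •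
      psiC K K' η s t L N N (l : ℤ) lam

/-- `φ_k = log( r(λ_k) ∏_{i≠k} α(λ_k,λ_i)/α(λ_i,λ_k) )`. -/
def phiG (K K' η : ℂ) (L : ℕ) {n : ℕ} (lam : Fin n → ℂ) (k : Fin n) : ℂ :=
  Complex.log (rJ K K' η L (lam k) *
    ∏ i ∈ univ.erase k, αJ K K' η (lam k) (lam i) / αJ K K' η (lam i) (lam k))


def gterm (a z τ : ℂ) (n : ℤ) : ℂ :=
  Complex.exp ((Real.pi : ℂ) * Complex.I * ((n : ℂ) + a) ^ 2 * τ +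
      2 * ((n : ℂ) + a) * Complex.I * z)

def gsum (a z τ : ℂ) : ℂ := ∑' n : ℤ, gterm a z τ n

lemma gterm_summable (a z : ℂ) {τ : ℂ} (hτ : 0 < τ.im) : Summable fun n => ‖gterm a z τ n‖ := by
  have h := ((summable_jacobiTheta₂_term_iff (z / Real.pi + a * τ) τ).2 hτ).norm.mul_left
    ‖Complex.exp ((Real.pi : ℂ) * Complex.I * a ^ 2 * τ + 2 * a * Complex.I * z)‖
  refine h.congr fun n => ?_
  rw [← norm_mul, jacobiTheta₂_term, ← Complex.exp_add, gterm]
  congr 2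
  have : (Real.pi : ℂ) ≠ 0 := by exact_mod_cast Real.pi_ne_zero
  field_simp
  ring

lemma tsum_split (f : ℤ × ℤ → ℂ) (hf : Summable f) :
    ∑' x, f x = ∑' x : ℤ × ℤ, f (x.1 + x.2, x.1 - x.2)
      + ∑' x : ℤ × ℤ, f (x.1 + x.2 + 1, x.1 - x.2) := by
  let e : (ℤ × ℤ) ⊕ (ℤ × ℤ) → ℤ × ℤ :=
    Sum.elim (fun x => (x.1 + x.2, x.1 - x.2)) (fun x => (x.1 + x.2 + 1, x.1 - x.2))
  have he : Function.Bijective e := by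
    constructor
    · rintro (⟨a, b⟩ | ⟨a, b⟩) (⟨c, d⟩ | ⟨c, d⟩) h <;>
        simp only [e, Sum.elim_inl, Sum.elim_inr, Prod.mk.injEq, Sum.inl.injEq, Sum.inr.injEq,
          reduceCtorEq] at h ⊢ <;> omega
    · rintro ⟨n, m⟩
      rcases Int.even_or_odd' (n + m) with ⟨k, hk | hk⟩
      · refine ⟨Sum.inl (k, n - k), ?_⟩
        simp only [e, Sum.elim_inl, Prod.mk.injEq]; omega
      · refine ⟨Sum.inr (k, n - k - 1), ?_⟩
        simp only [e, Sum.elim_inr, Prod.mk.injEq]; omega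
  let E := Equiv.ofBijective e he
  have hE : Summable (fun x => f (E x)) := E.summable_iff.2 hf
  rw [← E.tsum_eq f, Summable.tsum_sum (hE.comp_injective Sum.inl_injective)
    (hE.comp_injective Sum.inr_injective)]
  rfl

lemma gsum_mul (a b z w : ℂ) {τ : ℂ} (hτ : 0 < τ.im) :
    gsum a z τ * gsum b w τ = ∑' x : ℤ × ℤ, gterm a z τ x.1 * gterm b w τ x.2 :=
  tsum_mul_tsum_of_summable_norm (gterm_summable a z hτ) (gterm_summable b w hτ)

lemma gsum_even_zero (z τ : ℂ) : gsum 0 (-z) τ = gsum 0 z τ := by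
  unfold gsum
  rw [← (Equiv.neg ℤ).tsum_eq]
  refine tsum_congr fun n => ?_
  simp only [gterm, Equiv.neg_apply]
  congr 1; push_cast; ring

lemma gsum_even_half (z τ : ℂ) : gsum (1/2) (-z) τ = gsum (1/2) z τ := by
  unfold gsum
  rw [← (Equiv.subLeft (-1 : ℤ)).tsum_eq]
  refine tsum_congr fun n => ?_
  simp only [gterm, Equiv.subLeft_apply]
  congr 1; push_cast; ring

lemma negone_even (n : ℤ) (k : ℤ) (h : n = 2 * k) : (-1 : ℂ) ^ n = 1 := by
  subst h; exact Even.neg_one_zpow (even_two_mul k)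

lemma negone_odd (n : ℤ) (k : ℤ) (h : n = 2 * k + 1) : (-1 : ℂ) ^ n = -1 := by
  subst h; exact Odd.neg_one_zpow (odd_two_mul_add_one k)

lemma theta4_summable (z : ℂ) {τ : ℂ} (hτ : 0 < τ.im) :
    Summable fun n : ℤ => ‖(-1 : ℂ) ^ n * gterm 0 z τ n‖ := by
  refine (gterm_summable 0 z hτ).congr fun n => ?_
  simp

lemma theta1_summable (z : ℂ) {τ : ℂ} (hτ : 0 < τ.im) :
    Summable fun n : ℤ => ‖-Complex.I * (-1 : ℂ) ^ n * gterm (1/2) z τ n‖ := by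
  refine (gterm_summable (1/2) z hτ).congr fun n => ?_
  simp

lemma theta4_eq (z τ : ℂ) : theta4 z τ = ∑' n : ℤ, (-1 : ℂ) ^ n * gterm 0 z τ n := by
  unfold theta4 gterm; simp

lemma theta1_eq (z τ : ℂ) :
    theta1 z τ = ∑' n : ℤ, -Complex.I * (-1 : ℂ) ^ n * gterm (1/2) z τ n := by
  unfold theta1 gterm
  refine tsum_congr fun n => ?_
  congr 2; ring

lemma im_two {τ : ℂ} (hτ : 0 < τ.im) : 0 < (2 * τ).im := by simpa using hτ

lemma theta44 (u v : ℂ) {τ : ℂ} (hτ : 0 < τ.im) :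
    theta4 u τ * theta4 v τ = gsum 0 (u + v) (2 * τ) * gsum 0 (u - v) (2 * τ)
      - gsum (1/2) (u + v) (2 * τ) * gsum (1/2) (u - v) (2 * τ) := by
  rw [theta4_eq, theta4_eq,
    tsum_mul_tsum_of_summable_norm (theta4_summable u hτ) (theta4_summable v hτ),
    tsum_split _ (summable_mul_of_summable_norm (theta4_summable u hτ) (theta4_summable v hτ)),
    gsum_mul _ _ _ _ (im_two hτ), gsum_mul _ _ _ _ (im_two hτ), sub_eq_add_neg, ← tsum_neg]
  congr 1
  · refine tsum_congr fun ⟨p, q⟩ => ?_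
    have h : ((-1 : ℂ) ^ (p + q)) * (-1 : ℂ) ^ (p - q) = 1 := by
      rw [← zpow_add₀ (by norm_num)]; exact negone_even _ p (by ring)
    have h2 : gterm 0 u τ (p + q) * gterm 0 v τ (p - q)
        = gterm 0 (u + v) (2 * τ) p * gterm 0 (u - v) (2 * τ) q := by
      simp only [gterm, ← Complex.exp_add]; congr 1; push_cast; ring
    simp only
    rw [← h2]; linear_combination (gterm 0 u τ (p + q) * gterm 0 v τ (p - q)) * h
  · refine tsum_congr fun ⟨p, q⟩ => ?_
    have h : ((-1 : ℂ) ^ (p + q + 1)) * (-1 : ℂ) ^ (p - q) = -1 := by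
      rw [← zpow_add₀ (by norm_num)]; exact negone_odd _ p (by ring)
    have h2 : gterm 0 u τ (p + q + 1) * gterm 0 v τ (p - q)
        = gterm (1/2) (u + v) (2 * τ) p * gterm (1/2) (u - v) (2 * τ) q := by
      simp only [gterm, ← Complex.exp_add]; congr 1; push_cast; ring
    simp only
    rw [← h2]; linear_combination (gterm 0 u τ (p + q + 1) * gterm 0 v τ (p - q)) * h

lemma tsum_shift (f : ℤ × ℤ → ℂ) : ∑' x : ℤ × ℤ, f x = ∑' x : ℤ × ℤ, f (x.1 + 1, x.2) :=
  (((Equiv.addRight (1 : ℤ)).prodCongr (Equiv.refl ℤ)).tsum_eq f).symm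

lemma theta11 (u v : ℂ) {τ : ℂ} (hτ : 0 < τ.im) :
    theta1 u τ * theta1 v τ = gsum 0 (u + v) (2 * τ) * gsum (1/2) (u - v) (2 * τ)
      - gsum (1/2) (u + v) (2 * τ) * gsum 0 (u - v) (2 * τ) := by
  rw [theta1_eq, theta1_eq,
    tsum_mul_tsum_of_summable_norm (theta1_summable u hτ) (theta1_summable v hτ),
    tsum_split _ (summable_mul_of_summable_norm (theta1_summable u hτ) (theta1_summable v hτ)),
    gsum_mul _ _ _ _ (im_two hτ), gsum_mul _ _ _ _ (im_two hτ), sub_eq_add_neg, ← tsum_neg,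
    add_comm]
  congr 1
  · rw [tsum_shift (fun x : ℤ × ℤ => gterm 0 (u + v) (2 * τ) x.1 * gterm (1/2) (u - v) (2 * τ) x.2)]
    refine tsum_congr fun ⟨p, q⟩ => ?_
    have h : ((-1 : ℂ) ^ (p + q + 1)) * (-1 : ℂ) ^ (p - q) = -1 := by
      rw [← zpow_add₀ (by norm_num)]; exact negone_odd _ p (by ring)
    have h2 : gterm (1/2) u τ (p + q + 1) * gterm (1/2) v τ (p - q)
        = gterm 0 (u + v) (2 * τ) (p + 1) * gterm (1/2) (u - v) (2 * τ) q := by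
      simp only [gterm, ← Complex.exp_add]; congr 1; push_cast; ring
    simp only
    rw [← h2]
    linear_combination (Complex.I ^ 2 * gterm (1/2) u τ (p + q + 1) * gterm (1/2) v τ (p - q)) * h
      - (gterm (1/2) u τ (p + q + 1) * gterm (1/2) v τ (p - q)) * Complex.I_sq
  · refine tsum_congr fun ⟨p, q⟩ => ?_
    have h : ((-1 : ℂ) ^ (p + q)) * (-1 : ℂ) ^ (p - q) = 1 := by
      rw [← zpow_add₀ (by norm_num)]; exact negone_even _ p (by ring)
    have h2 : gterm (1/2) u τ (p + q) * gterm (1/2) v τ (p - q)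
        = gterm (1/2) (u + v) (2 * τ) p * gterm 0 (u - v) (2 * τ) q := by
      simp only [gterm, ← Complex.exp_add]; congr 1; push_cast; ring
    simp only
    rw [← h2]
    linear_combination (Complex.I ^ 2 * gterm (1/2) u τ (p + q) * gterm (1/2) v τ (p - q)) * h
      + (gterm (1/2) u τ (p + q) * gterm (1/2) v τ (p - q)) * Complex.I_sq

/-- Product formulas in the original variables. -/
lemma exists_AB (K K' : ℂ) (hτ : 0 < (Complex.I * K' / K).im) :
    ∃ A B : ℂ → ℂ, (∀ x, A (-x) = A x) ∧ (∀ x, B (-x) = B x) ∧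
      (∀ u v, ΘJ K K' u * ΘJ K K' v = A (u + v) * A (u - v) - B (u + v) * B (u - v)) ∧
      (∀ u v, HJ K K' u * HJ K K' v = A (u + v) * B (u - v) - B (u + v) * A (u - v)) := by
  refine ⟨fun x => gsum 0 ((Real.pi : ℂ) * x / (2 * K)) (2 * (Complex.I * K' / K)),
    fun x => gsum (1/2) ((Real.pi : ℂ) * x / (2 * K)) (2 * (Complex.I * K' / K)), ?_, ?_, ?_, ?_⟩
  · intro x
    simp only
    rw [← gsum_even_zero]; congr 1; ring
  · intro x
    simp only
    rw [← gsum_even_half]; congr 1; ring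
  · intro u v
    simp only [ΘJ]
    rw [theta44 _ _ hτ]
    congr 3 <;> ring
  · intro u v
    simp only [HJ]
    rw [theta11 _ _ hτ]
    congr 3 <;> ring

lemma Lsite_eq (K K' η μ : ℂ) : Lsite K K' η μ =
    !![!![w4p3 K K' η μ, 0; 0, w4m3 K K' η μ], !![0, w1m2 K K' η μ; w1p2 K K' η μ, 0];
       !![0, w1p2 K K' η μ; w1m2 K K' η μ, 0], !![w4m3 K K' η μ, 0; 0, w4p3 K K' η μ]] := by
  have hI := Complex.I_mul_I
  ext i j k l
  fin_cases i <;> fin_cases j <;> fin_cases k <;> fin_cases l <;>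
    simp [Lsite, σx, σy, σz, wc1, wc2, wc3, wc4] <;> try ring_nf
  all_goals simp
  all_goals ring

set_option maxHeartbeats 2000000 in
lemma ybe_alg (K K' η lam mu a b c d a1 b1 c1 d1 a2 b2 c2 d2 : ℂ)
   (ha : aJ K K' η lam mu = a) (hb : bJ K K' η lam mu = b) (hc : cJ K K' η lam mu = c)
   (hd : dJ K K' η lam mu = d)
   (ha1 : w4p3 K K' η lam = a1) (hb1 : w4m3 K K' η lam = b1) (hc1 : w1p2 K K' η lam = c1)
   (hd1 : w1m2 K K' η lam = d1)
   (ha2 : w4p3 K K' η mu = a2) (hb2 : w4m3 K K' η mu = b2) (hc2 : w1p2 K K' η mu = c2)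
   (hd2 : w1m2 K K' η mu = d2)
   (e1 : a * a1 * d2 + d * c1 * a2 = c * b1 * d2 + b * d1 * a2)
   (e2 : a * b1 * c2 + d * d1 * b2 = c * a1 * c2 + b * c1 * b2)
   (e3 : a * d1 * b2 + d * b1 * c2 = c * d1 * a2 + b * b1 * d2)
   (e4 : a * c1 * a2 + d * a1 * d2 = c * c1 * b2 + b * a1 * c2)
   (e5 : a * d1 * c2 + d * b1 * b2 = a * c1 * d2 + d * a1 * a2)
   (e6 : b * a1 * b2 + c * c1 * c2 = b * b1 * a2 + c * d1 * d2) :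
    (Rc K K' η lam mu).map (fun z => z • (1 : Matrix (Fin 2) (Fin 2) ℂ)) *
        (Lsite K K' η lam ⊗ₖ Lsite K K' η mu) =
      (Lsite K K' η mu ⊗ₖ Lsite K K' η lam) *
        (Rc K K' η lam mu).map (fun z => z • (1 : Matrix (Fin 2) (Fin 2) ℂ)) := by
  rw [Lsite_eq, Lsite_eq, ha1, hb1, hc1, hd1, ha2, hb2, hc2, hd2]
  ext ⟨i, j⟩ ⟨k, l⟩ m n
  fin_cases i <;> fin_cases j <;> fin_cases k <;> fin_cases l <;>
    simp [Matrix.mul_apply, Fintype.sum_prod_type, Rc, ha, hb, hc, hd] <;>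
    fin_cases m <;> fin_cases n <;> simp
  all_goals first
    | ring1
    | linear_combination e1
    | linear_combination e2
    | linear_combination e3
    | linear_combination e4
    | linear_combination e5
    | linear_combination e6
    | linear_combination -e1
    | linear_combination -e2
    | linear_combination -e3
    | linear_combination -e4
    | linear_combination -e5
    | linear_combination -e6

lemma quartics (K K' : ℂ) (hτ : 0 < (Complex.I * K' / K).im) (z : ℂ) (H T : ℂ → ℂ)
    (hH : H = HJ K K') (hT : T = ΘJ K K') :
    (∀ x, T (-x) * T 0 = T x * T 0) ∧
    (∀ x y, T x * T (x + z) * T y * T (y + z) - H x * H (x + z) * H y * H (y + z)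
      = T 0 * T z * T (x + y + z) * T (x - y)) ∧
    (∀ x y, T x * H (x + z) * T y * H (y + z) - H x * T (x + z) * H y * T (y + z)
      = T 0 * H z * H (x + y + z) * T (x - y)) ∧
    (∀ x y, T x * H (x + z) * H y * T (y + z) - H x * T (x + z) * T y * H (y + z)
      = T 0 * H z * T (x + y + z) * H (y - x)) ∧
    (∀ x y, T x * T (x + z) * H y * H (y + z) - H x * H (x + z) * T y * T (y + z)
      = T 0 * T z * H (x + y + z) * H (y - x)) := by
  obtain ⟨A, B, hA, hB, hTT, hHH⟩ := exists_AB K K' hτ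
  rw [← hT] at hTT
  rw [← hH] at hHH
  have kT : ∀ u v s d, u + v = s → u - v = d → T u * T v = A s * A d - B s * B d := by
    rintro u v _ _ rfl rfl; exact hTT u v
  have kH : ∀ u v s d, u + v = s → u - v = d → H u * H v = A s * B d - B s * A d := by
    rintro u v _ _ rfl rfl; exact hHH u v
  refine ⟨fun x => ?_, fun x y => ?_, fun x y => ?_, fun x y => ?_, fun x y => ?_⟩
  · rw [hTT, hTT]; simp [hA, hB]
  · have h1 := kT x (y + z) (x + y + z) (x - y - z) (by ring) (by ring)
    have h2 := kT (x + z) y (x + y + z) (x - y + z) (by ring) (by ring)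
    have h3 := kH x (y + z) (x + y + z) (x - y - z) (by ring) (by ring)
    have h4 := kH (x + z) y (x + y + z) (x - y + z) (by ring) (by ring)
    have h5 := kT (x + y + z) 0 (x + y + z) (x + y + z) (by ring) (by ring)
    have h6 := kT z (x - y) (x - y + z) (-(x - y - z)) (by ring) (by ring)
    rw [hA, hB] at h6
    calc _ = (T x * T (y + z)) * (T (x + z) * T y) - (H x * H (y + z)) * (H (x + z) * H y) := by
          ring
      _ = (T (x + y + z) * T 0) * (T z * T (x - y)) := by
          rw [h1, h2, h3, h4, h5, h6]; ring
      _ = _ := by ring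
  · have h1 := kT x y (x + y) (x - y) (by ring) (by ring)
    have h2 := kH (x + z) (y + z) (x + y + 2 * z) (x - y) (by ring) (by ring)
    have h3 := kH x y (x + y) (x - y) (by ring) (by ring)
    have h4 := kT (x + z) (y + z) (x + y + 2 * z) (x - y) (by ring) (by ring)
    have h5 := kT (x - y) 0 (x - y) (x - y) (by ring) (by ring)
    have h6 := kH z (x + y + z) (x + y + 2 * z) (-(x + y)) (by ring) (by ring)
    rw [hA, hB] at h6
    calc _ = (T x * T y) * (H (x + z) * H (y + z)) - (H x * H y) * (T (x + z) * T (y + z)) := by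
          ring
      _ = (T (x - y) * T 0) * (H z * H (x + y + z)) := by
          rw [h1, h2, h3, h4, h5, h6]; ring
      _ = _ := by ring
  · have h1 := kT x (y + z) (x + y + z) (x - y - z) (by ring) (by ring)
    have h2 := kH (x + z) y (x + y + z) (x - y + z) (by ring) (by ring)
    have h3 := kH x (y + z) (x + y + z) (x - y - z) (by ring) (by ring)
    have h4 := kT (x + z) y (x + y + z) (x - y + z) (by ring) (by ring)
    have h5 := kT (x + y + z) 0 (x + y + z) (x + y + z) (by ring) (by ring)
    have h6 := kH z (y - x) (-(x - y - z)) (x - y + z) (by ring) (by ring)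
    rw [hA, hB] at h6
    calc _ = (T x * T (y + z)) * (H (x + z) * H y) - (H x * H (y + z)) * (T (x + z) * T y) := by
          ring
      _ = (T (x + y + z) * T 0) * (H z * H (y - x)) := by
          rw [h1, h2, h3, h4, h5, h6]; ring
      _ = _ := by ring
  · have h1 := kT x (x + z) (2 * x + z) (-z) (by ring) (by ring)
    have h2 := kH y (y + z) (2 * y + z) (-z) (by ring) (by ring)
    have h3 := kH x (x + z) (2 * x + z) (-z) (by ring) (by ring)
    have h4 := kT y (y + z) (2 * y + z) (-z) (by ring) (by ring)
    have h5 := kT z 0 z z (by ring) (by ring)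
    have h6 := kH (x + y + z) (y - x) (2 * y + z) (2 * x + z) (by ring) (by ring)
    rw [hA, hB] at h1 h2 h3 h4
    calc _ = (T x * T (x + z)) * (H y * H (y + z)) - (H x * H (x + z)) * (T y * T (y + z)) := by
          ring
      _ = (T z * T 0) * (H (x + y + z) * H (y - x)) := by
          rw [h1, h2, h3, h4, h5, h6]; ring
      _ = _ := by ring

/-- the local Yang–Baxter equation
`R(λ,μ)·(L_n(λ) ⊗ L_n(μ)) = (L_n(μ) ⊗ L_n(λ))·R(λ,μ)`, as an identity of 4×4 matrices
whose entries are operators on the site Hilbert space ℂ². -/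
theorem xyz_local_yang_baxter (K K' η : ℂ) (hτ : 0 < (Complex.I * K' / K).im)
    (lam mu : ℂ) :
    (Rc K K' η lam mu).map (fun z => z • (1 : Matrix (Fin 2) (Fin 2) ℂ)) *
        (Lsite K K' η lam ⊗ₖ Lsite K K' η mu) =
      (Lsite K K' η mu ⊗ₖ Lsite K K' η lam) *
        (Rc K K' η lam mu).map (fun z => z • (1 : Matrix (Fin 2) (Fin 2) ℂ)) := by
  obtain ⟨q0, q1, q2, q3, q4⟩ := quartics K K' hτ (2 * η) (HJ K K') (ΘJ K K') rfl rfl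
  obtain ⟨u, rfl⟩ : ∃ u, lam = u + η := ⟨lam - η, by ring⟩
  obtain ⟨v, rfl⟩ : ∃ v, mu = v + η := ⟨mu - η, by ring⟩
  have s1 : u + η - (v + η) = u - v := by ring
  have s2 : ∀ x, x + η + η = x + 2 * η := fun x => by ring
  have s3 : ∀ x, x + η - η = x := fun x => by ring
  generalize hw : u - v = w at *
  have hu : u = v + w := by rw [← hw]; ring
  apply ybe_alg K K' η (u + η) (v + η) _ _ _ _ _ _ _ _ _ _ _ _ rfl rfl rfl rfl rfl rfl rfl rfl
    rfl rfl rfl rfl <;>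
  simp only [aJ, bJ, cJ, dJ, w4p3, w4m3, w1p2, w1m2, s1, s2, s3]
  all_goals clear hτ
  all_goals generalize ΘJ K K' = T at *
  all_goals generalize HJ K K' = H at *
  all_goals generalize 2 * η = z at *
  · have p := q2 w u
    have r := q4 w u
    have e := q0 v
    rw [show w - u = -v by rw [hu]; ring] at p
    rw [show u - w = v by rw [hu]; ring] at r
    linear_combination (H z * H v * H (v + z) * T z ^ 2) * p
      - (T z * T v * H (v + z) * H z ^ 2) * r
      + (H z * H v * H (v + z) * T z ^ 2 * H z * H (w + u + z)) * e
  · have p := q3 w u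
    have r := q1 u w
    rw [show u - w = v by rw [hu]; ring] at p r
    rw [show w + u + z = u + w + z by ring] at p
    linear_combination (H z * T v * T (v + z) * T z ^ 2) * p
      - (T z * H v * T (v + z) * H z ^ 2) * r
  · have p := q3 w v
    have r := q4 w v
    rw [show w + v + z = u + z by rw [hu]; ring] at p r
    linear_combination (H z * H u * H (u + z) * T z ^ 2) * p
      - (T z * H u * T (u + z) * H z ^ 2) * r
  · have p := q2 w v
    have r := q1 w v
    rw [show w + v + z = u + z by rw [hu]; ring] at p r
    linear_combination (H z * T u * T (u + z) * T z ^ 2) * p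
      - (T z * T u * H (u + z) * H z ^ 2) * r
  · have p := q4 v u
    have r := q2 u v
    rw [hw] at p r
    rw [show v + u + z = u + v + z by ring] at p
    linear_combination (T z * T w * H (w + z) * H z ^ 2) * p
      - (H z * H w * H (w + z) * T z ^ 2) * r
  · have p := q3 v u
    have r := q1 u v
    rw [hw] at p r
    rw [show v + u + z = u + v + z by ring] at p
    linear_combination -(H z * T w * T (w + z) * T z ^ 2) * p
      + (T z * H w * T (w + z) * H z ^ 2) * r

end
end

section
/- The off-diagonal entries of the gauge-transformed L-operator annihilate the local vacuums: γ_n^l(μ)|ω_n^l⟩ = 0 and ⟨ω_n^l|β_n^l(μ) = 0 for all μ ∈ ℂ. -/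
open Complex Matrix Finset
open scoped Kronecker

noncomputable section

theorem aux_prod (x y τ : ℂ) (hτ : 0 < τ.im) :
    jacobiTheta₂ x τ * jacobiTheta₂ y τ =
      jacobiTheta₂ (x + y) (2 * τ) * jacobiTheta₂ (x - y) (2 * τ) +
      Complex.exp (Real.pi * Complex.I * τ + 2 * Real.pi * Complex.I * x) *
        (jacobiTheta₂ (x + y + τ) (2 * τ) * jacobiTheta₂ (x - y + τ) (2 * τ)) := by
  have h2 : 0 < (2 * τ).im := by simpa using hτ
  have hs : ∀ z, Summable (fun n => ‖jacobiTheta₂_term n z τ‖) := fun z =>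
    ((summable_jacobiTheta₂_term_iff z τ).2 hτ).norm
  have hs2 : ∀ z, Summable (fun n => ‖jacobiTheta₂_term n z (2 * τ)‖) := fun z =>
    ((summable_jacobiTheta₂_term_iff z (2 * τ)).2 h2).norm
  let φ : (ℤ × ℤ) ⊕ (ℤ × ℤ) → ℤ × ℤ := Sum.elim (fun p => (p.1 + p.2, p.1 - p.2))
    (fun p => (p.1 + p.2 + 1, p.1 - p.2))
  have hφ : Function.Bijective φ := by
    constructor
    · rintro (⟨a, b⟩ | ⟨a, b⟩) (⟨c, d⟩ | ⟨c, d⟩) h <;>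
        simp only [φ, Sum.elim_inl, Sum.elim_inr, Prod.mk.injEq, reduceCtorEq, Sum.inl.injEq,
          Sum.inr.injEq] at h ⊢ <;> omega
    · rintro ⟨m, n⟩
      rcases Int.even_or_odd' (m + n) with ⟨j, hj | hj⟩
      · refine ⟨Sum.inl (j, m - j), ?_⟩
        simp only [φ, Sum.elim_inl, Prod.mk.injEq]; omega
      · refine ⟨Sum.inr (j, m - j - 1), ?_⟩
        simp only [φ, Sum.elim_inr, Prod.mk.injEq]; omega
  let e := Equiv.ofBijective φ hφ
  have hsum := summable_mul_of_summable_norm (hs x) (hs y)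
  have hsum' := (e.summable_iff).2 hsum
  unfold jacobiTheta₂
  rw [tsum_mul_tsum_of_summable_norm (hs x) (hs y), tsum_mul_tsum_of_summable_norm (hs2 _) (hs2 _),
    tsum_mul_tsum_of_summable_norm (hs2 _) (hs2 _), ← tsum_mul_left, ← e.tsum_eq]
  rw [Summable.tsum_sum (f := fun c => jacobiTheta₂_term (e c).1 x τ * jacobiTheta₂_term (e c).2 y τ)
    (hsum'.comp_injective Sum.inl_injective) (hsum'.comp_injective Sum.inr_injective)]
  congr 1
  · refine tsum_congr fun p => ?_
    simp only [e, Equiv.ofBijective_apply, φ, Sum.elim_inl, jacobiTheta₂_term, ← Complex.exp_add]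
    congr 1; push_cast; ring
  · refine tsum_congr fun p => ?_
    simp only [e, Equiv.ofBijective_apply, φ, Sum.elim_inr, jacobiTheta₂_term, ← Complex.exp_add]
    congr 1; push_cast; ring

theorem aux_negone (n : ℤ) : (-1 : ℂ) ^ n = Complex.exp (Real.pi * Complex.I * n) := by
  rw [← Complex.exp_pi_mul_I, ← Complex.exp_int_mul]; congr 1; ring

theorem aux_t4 (z τ : ℂ) : theta4 z τ = jacobiTheta₂ (z / Real.pi + 1 / 2) τ := by
  have hpi : (Real.pi : ℂ) ≠ 0 := by exact_mod_cast Real.pi_ne_zero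
  unfold theta4 jacobiTheta₂ jacobiTheta₂_term
  refine tsum_congr fun n => ?_
  rw [aux_negone, ← Complex.exp_add]
  congr 1; field_simp; ring

theorem aux_t1 (z τ : ℂ) : theta1 z τ = -Complex.I * Complex.exp (Real.pi * Complex.I * τ / 4 +
    Complex.I * z) * jacobiTheta₂ (z / Real.pi + τ / 2 + 1 / 2) τ := by
  have hpi : (Real.pi : ℂ) ≠ 0 := by exact_mod_cast Real.pi_ne_zero
  unfold theta1 jacobiTheta₂ jacobiTheta₂_term
  rw [← tsum_mul_left]
  refine tsum_congr fun n => ?_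
  rw [aux_negone, mul_assoc (-Complex.I), mul_assoc (-Complex.I), ← Complex.exp_add,
    ← Complex.exp_add]
  congr 2; field_simp; ring

def auxA (z τ : ℂ) : ℂ := jacobiTheta₂ (z / Real.pi) (2 * τ)
def auxB (z τ : ℂ) : ℂ := Complex.exp (Real.pi * Complex.I * τ / 2 + Complex.I * z) *
  jacobiTheta₂ (z / Real.pi + τ) (2 * τ)

theorem aux_44 (x y τ : ℂ) (hτ : 0 < τ.im) : theta4 x τ * theta4 y τ =
    auxA (x + y) τ * auxA (x - y) τ - auxB (x + y) τ * auxB (x - y) τ := by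
  have hpi : (Real.pi : ℂ) ≠ 0 := by exact_mod_cast Real.pi_ne_zero
  rw [aux_t4, aux_t4, aux_prod _ _ _ hτ]
  unfold auxA auxB
  have e1 : x / (Real.pi : ℂ) + 1 / 2 + (y / Real.pi + 1 / 2) = (x + y) / Real.pi + 1 := by ring
  have e2 : x / (Real.pi : ℂ) + 1 / 2 - (y / Real.pi + 1 / 2) = (x - y) / Real.pi := by ring
  have e3 : (x + y) / (Real.pi : ℂ) + 1 + τ = (x + y) / Real.pi + τ + 1 := by ring
  have e4 : Complex.exp (Real.pi * Complex.I * τ + 2 * Real.pi * Complex.I *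
      (x / Real.pi + 1 / 2)) = - (Complex.exp (Real.pi * Complex.I * τ / 2 + Complex.I * (x + y)) *
      Complex.exp (Real.pi * Complex.I * τ / 2 + Complex.I * (x - y))) := by
    rw [← Complex.exp_add, neg_eq_neg_one_mul, ← Complex.exp_pi_mul_I, ← Complex.exp_add]
    congr 1; field_simp; ring
  rw [e1, e2, e3, e4, jacobiTheta₂_add_left, jacobiTheta₂_add_left]
  ring

theorem aux_11 (x y τ : ℂ) (hτ : 0 < τ.im) : theta1 x τ * theta1 y τ =
    auxA (x + y) τ * auxB (x - y) τ - auxB (x + y) τ * auxA (x - y) τ := by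
  have hpi : (Real.pi : ℂ) ≠ 0 := by exact_mod_cast Real.pi_ne_zero
  rw [aux_t1, aux_t1, mul_mul_mul_comm, aux_prod _ _ _ hτ]
  unfold auxA auxB
  have e1 : x / (Real.pi : ℂ) + τ / 2 + 1 / 2 + (y / Real.pi + τ / 2 + 1 / 2) =
    (x + y) / Real.pi + τ + 1 := by ring
  have e2 : x / (Real.pi : ℂ) + τ / 2 + 1 / 2 - (y / Real.pi + τ / 2 + 1 / 2) =
    (x - y) / Real.pi := by ring
  have e3 : (x + y) / (Real.pi : ℂ) + τ + 1 + τ = (x + y) / Real.pi + 2 * τ + 1 := by ring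
  have e5 : -Complex.I * Complex.exp (Real.pi * Complex.I * τ / 4 + Complex.I * x) *
      (-Complex.I * Complex.exp (Real.pi * Complex.I * τ / 4 + Complex.I * y)) =
      - Complex.exp (Real.pi * Complex.I * τ / 2 + Complex.I * (x + y)) := by
    rw [mul_mul_mul_comm, ← Complex.exp_add, neg_mul_neg, Complex.I_mul_I, neg_one_mul]
    congr 2; ring
  have e6 : Complex.exp (Real.pi * Complex.I * τ / 2 + Complex.I * (x + y)) *
      (Complex.exp (Real.pi * Complex.I * τ + 2 * Real.pi * Complex.I *
      (x / Real.pi + τ / 2 + 1 / 2)) *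
      Complex.exp (-Real.pi * Complex.I * (2 * τ + 2 * ((x + y) / Real.pi)))) =
      - Complex.exp (Real.pi * Complex.I * τ / 2 + Complex.I * (x - y)) := by
    rw [← Complex.exp_add, ← Complex.exp_add, neg_eq_neg_one_mul (Complex.exp _),
      ← Complex.exp_pi_mul_I, ← Complex.exp_add]
    congr 1; field_simp; ring
  rw [e1, e2, e3, e5, jacobiTheta₂_add_left, jacobiTheta₂_add_left, jacobiTheta₂_add_left']
  linear_combination (-(jacobiTheta₂ ((x + y) / Real.pi) (2 * τ) *
    jacobiTheta₂ ((x - y) / Real.pi + τ) (2 * τ))) * e6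

theorem aux_C0 (x y u τ : ℂ) (hτ : 0 < τ.im) :
    theta1 x τ * theta1 y τ * theta1 u τ * theta1 (u + x + y) τ +
      theta4 x τ * theta4 y τ * theta4 u τ * theta4 (u + x + y) τ =
    theta4 0 τ * theta4 (x + y) τ * theta4 (u + x) τ * theta4 (u + y) τ := by
  have h1 := aux_11 x y τ hτ
  have h2 := aux_11 (u + x + y) u τ hτ
  have h3 := aux_44 x y τ hτ
  have h4 := aux_44 (u + x + y) u τ hτ
  have h5 := aux_44 (x + y) 0 τ hτ
  have h6 := aux_44 (u + x) (u + y) τ hτ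
  rw [show u + x + y - u = x + y by ring] at h2 h4
  rw [show u + x + (u + y) = u + x + y + u by ring, show u + x - (u + y) = x - y by ring] at h6
  rw [add_zero, sub_zero] at h5
  calc _ = (theta1 x τ * theta1 y τ) * (theta1 (u + x + y) τ * theta1 u τ) +
        (theta4 x τ * theta4 y τ) * (theta4 (u + x + y) τ * theta4 u τ) := by ring
    _ = (theta4 (x + y) τ * theta4 0 τ) * (theta4 (u + x) τ * theta4 (u + y) τ) := by
        rw [h1, h2, h3, h4, h5, h6]; ring
    _ = _ := by ring

def auxE (z τ : ℂ) : ℂ := Complex.I * Complex.exp (-(Real.pi * Complex.I * τ / 4) - Complex.I * z)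

theorem auxE_ne (z τ : ℂ) : auxE z τ ≠ 0 := mul_ne_zero Complex.I_ne_zero (Complex.exp_ne_zero _)

theorem auxE_mul (a b c d τ : ℂ) (h : a + b = c + d) :
    auxE a τ * auxE b τ = auxE c τ * auxE d τ := by
  unfold auxE
  rw [mul_mul_mul_comm, mul_mul_mul_comm Complex.I _ Complex.I, ← Complex.exp_add, ← Complex.exp_add]
  congr 2; linear_combination (-Complex.I) * h

theorem aux_s1 (z τ : ℂ) : theta1 (z + Real.pi * τ / 2) τ = auxE z τ * theta4 z τ := by
  unfold theta1 theta4 auxE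
  rw [← (Equiv.addRight (1 : ℤ)).tsum_eq (fun n : ℤ => (-1 : ℂ) ^ n * _), ← tsum_mul_left]
  refine tsum_congr fun n => ?_
  simp only [Equiv.coe_addRight]
  rw [zpow_add₀ (by norm_num), zpow_one]
  calc _ = -Complex.I * (-1 : ℂ) ^ n * Complex.exp ((-(Real.pi * Complex.I * τ / 4) -
        Complex.I * z) + (Real.pi * Complex.I * ((n + 1 : ℤ) : ℂ) ^ 2 * τ +
        2 * ((n + 1 : ℤ) : ℂ) * Complex.I * z)) := by
        congr 2; push_cast; ring
    _ = _ := by rw [Complex.exp_add]; ring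

theorem aux_s4 (z τ : ℂ) : theta4 (z + Real.pi * τ / 2) τ = auxE z τ * theta1 z τ := by
  unfold theta1 theta4 auxE
  rw [← tsum_mul_left]
  refine tsum_congr fun n => ?_
  calc _ = (-1 : ℂ) ^ n * Complex.exp ((-(Real.pi * Complex.I * τ / 4) -
        Complex.I * z) + (Real.pi * Complex.I * ((n : ℂ) + 1 / 2) ^ 2 * τ +
        (2 * (n : ℂ) + 1) * Complex.I * z)) := by
        congr 2; ring
    _ = _ := by
        rw [Complex.exp_add]
        linear_combination ((-1 : ℂ) ^ n * Complex.exp (-(Real.pi * Complex.I * τ / 4) -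
          Complex.I * z) * Complex.exp (Real.pi * Complex.I * ((n : ℂ) + 1 / 2) ^ 2 * τ +
          (2 * (n : ℂ) + 1) * Complex.I * z)) * Complex.I_sq

theorem aux_n1 (z τ : ℂ) : theta1 (-z) τ = - theta1 z τ := by
  unfold theta1
  rw [← (Equiv.subLeft (-1 : ℤ)).tsum_eq, ← tsum_neg]
  refine tsum_congr fun n => ?_
  simp only [Equiv.subLeft_apply]
  have : (-1 : ℂ) ^ (-1 - n) = - (-1) ^ n := by
    rw [zpow_sub₀ (by norm_num), div_eq_mul_inv, ← _root_.inv_zpow]; norm_num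
  rw [this]
  rw [mul_neg, neg_mul]
  congr 3; push_cast; ring

theorem aux_n4 (z τ : ℂ) : theta4 (-z) τ = theta4 z τ := by
  unfold theta4
  rw [← (Equiv.neg ℤ).tsum_eq]
  refine tsum_congr fun n => ?_
  simp only [Equiv.neg_apply]
  rw [_root_.zpow_neg, ← _root_.inv_zpow]
  norm_num

theorem aux_A0 (x y u τ : ℂ) (hτ : 0 < τ.im) :
    theta4 x τ * theta4 y τ * theta1 u τ * theta1 (u + x + y) τ +
      theta1 x τ * theta1 y τ * theta4 u τ * theta4 (u + x + y) τ =
    theta4 0 τ * theta4 (x + y) τ * theta1 (u + x) τ * theta1 (u + y) τ := by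
  have h := aux_C0 x y (u + Real.pi * τ / 2) τ hτ
  rw [show u + Real.pi * τ / 2 + x + y = u + x + y + Real.pi * τ / 2 by ring,
    show u + Real.pi * τ / 2 + x = u + x + Real.pi * τ / 2 by ring,
    show u + Real.pi * τ / 2 + y = u + y + Real.pi * τ / 2 by ring] at h
  simp only [aux_s1, aux_s4] at h
  have hE := auxE_mul u (u + x + y) (u + x) (u + y) τ (by ring)
  apply mul_left_cancel₀ (mul_ne_zero (auxE_ne u τ) (auxE_ne (u + x + y) τ))
  linear_combination h - (theta4 0 τ * theta4 (x + y) τ * theta1 (u + x) τ * theta1 (u + y) τ) * hE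

theorem aux_B0 (x y u τ : ℂ) (hτ : 0 < τ.im) :
    theta1 x τ * theta4 y τ * theta1 u τ * theta4 (u + x + y) τ +
      theta4 x τ * theta1 y τ * theta4 u τ * theta1 (u + x + y) τ =
    theta4 0 τ * theta1 (x + y) τ * theta4 (u + x) τ * theta1 (u + y) τ := by
  have h := aux_C0 x (y + Real.pi * τ / 2) u τ hτ
  simp only [← add_assoc] at h
  simp only [aux_s1, aux_s4] at h
  have hE := auxE_mul y (u + x + y) (x + y) (u + y) τ (by ring)
  apply mul_left_cancel₀ (mul_ne_zero (auxE_ne y τ) (auxE_ne (u + x + y) τ))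
  linear_combination h - (theta4 0 τ * theta1 (x + y) τ * theta4 (u + x) τ * theta1 (u + y) τ) * hE

section
variable (K K' : ℂ)

theorem auxJ_A (hτ : 0 < (Complex.I * K' / K).im) (x y u a b c v : ℂ) (hv : v = u + x + y)
    (ha : a = x + y) (hb : b = u + x) (hc : c = u + y) :
    ΘJ K K' x * ΘJ K K' y * HJ K K' u * HJ K K' v + HJ K K' x * HJ K K' y * ΘJ K K' u * ΘJ K K' v =
    ΘJ K K' 0 * ΘJ K K' a * HJ K K' b * HJ K K' c := by
  subst hv ha hb hc
  have := aux_A0 (Real.pi * x / (2 * K)) (Real.pi * y / (2 * K)) (Real.pi * u / (2 * K)) _ hτ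
  simpa only [HJ, ΘJ, mul_add, add_div, mul_zero, zero_div] using this

theorem auxJ_B (hτ : 0 < (Complex.I * K' / K).im) (x y u a b c v : ℂ) (hv : v = u + x + y)
    (ha : a = x + y) (hb : b = u + x) (hc : c = u + y) :
    HJ K K' x * ΘJ K K' y * HJ K K' u * ΘJ K K' v + ΘJ K K' x * HJ K K' y * ΘJ K K' u * HJ K K' v =
    ΘJ K K' 0 * HJ K K' a * ΘJ K K' b * HJ K K' c := by
  subst hv ha hb hc
  have := aux_B0 (Real.pi * x / (2 * K)) (Real.pi * y / (2 * K)) (Real.pi * u / (2 * K)) _ hτ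
  simpa only [HJ, ΘJ, mul_add, add_div, mul_zero, zero_div] using this

theorem auxJ_C (hτ : 0 < (Complex.I * K' / K).im) (x y u a b c v : ℂ) (hv : v = u + x + y)
    (ha : a = x + y) (hb : b = u + x) (hc : c = u + y) :
    HJ K K' x * HJ K K' y * HJ K K' u * HJ K K' v + ΘJ K K' x * ΘJ K K' y * ΘJ K K' u * ΘJ K K' v =
    ΘJ K K' 0 * ΘJ K K' a * ΘJ K K' b * ΘJ K K' c := by
  subst hv ha hb hc
  have := aux_C0 (Real.pi * x / (2 * K)) (Real.pi * y / (2 * K)) (Real.pi * u / (2 * K)) _ hτ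
  simpa only [HJ, ΘJ, mul_add, add_div, mul_zero, zero_div] using this

theorem auxJ_nH (x : ℂ) : HJ K K' (-x) = - HJ K K' x := by
  simp only [HJ, mul_neg, neg_div, aux_n1]

theorem auxJ_nT (x : ℂ) : ΘJ K K' (-x) = ΘJ K K' x := by
  simp only [ΘJ, mul_neg, neg_div, aux_n4]

end

theorem aux_L00 (K K' η μ : ℂ) : wc4 K K' η μ • (1 : Matrix (Fin 2) (Fin 2) ℂ) +
    wc3 K K' η μ • σz = !![w4p3 K K' η μ, 0; 0, w4m3 K K' η μ] := by
  ext i j; fin_cases i <;> fin_cases j <;> simp [wc4, wc3, σz] <;> ring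

theorem aux_L11 (K K' η μ : ℂ) : wc4 K K' η μ • (1 : Matrix (Fin 2) (Fin 2) ℂ) -
    wc3 K K' η μ • σz = !![w4m3 K K' η μ, 0; 0, w4p3 K K' η μ] := by
  ext i j; fin_cases i <;> fin_cases j <;> simp [wc4, wc3, σz] <;> ring

theorem aux_L01 (K K' η μ : ℂ) : wc1 K K' η μ • σx - (Complex.I * wc2 K K' η μ) • σy =
    !![0, w1m2 K K' η μ; w1p2 K K' η μ, 0] := by
  ext i j; fin_cases i <;> fin_cases j <;> simp [wc1, wc2, σx, σy] <;> ring_nf <;>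
    simp [Complex.I_sq] <;> ring

theorem aux_L10 (K K' η μ : ℂ) : wc1 K K' η μ • σx + (Complex.I * wc2 K K' η μ) • σy =
    !![0, w1p2 K K' η μ; w1m2 K K' η μ, 0] := by
  ext i j; fin_cases i <;> fin_cases j <;> simp [wc1, wc2, σx, σy] <;> ring_nf <;>
    simp [Complex.I_sq] <;> ring

/-- `γ_n^l(μ)|ω_n^l⟩ = 0` and `⟨ω_n^l|β_n^l(μ) = 0` for all μ. -/
theorem gauge_offdiag_annihilate (K K' η s t : ℂ) (hτ : 0 < (Complex.I * K' / K).im)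
    (Q : ℕ) (hQ : 0 < Q) (hη : (Q : ℂ) * η = 2 * K) (n l : ℤ) :
    ∀ μ : ℂ,
      (Lg K K' η s t n l μ 1 0).mulVec (ωvec K K' η s (n + l)) = 0 ∧
      Matrix.vecMul (ωdual K K' η t (n + l)) (Lg K K' η s t n l μ 0 1) = 0 := by
  intro μ
  set k : ℤ := n + l with hk
  have hk1 : ((k - 1 : ℤ) : ℂ) = (k : ℂ) - 1 := by push_cast; ring
  have eL : Lsite K K' η μ = !![!![w4p3 K K' η μ, 0; 0, w4m3 K K' η μ],
      !![0, w1m2 K K' η μ; w1p2 K K' η μ, 0]; !![0, w1p2 K K' η μ; w1m2 K K' η μ, 0],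
      !![w4m3 K K' η μ, 0; 0, w4p3 K K' η μ]] := by
    rw [Lsite, aux_L00, aux_L01, aux_L10, aux_L11]
  have eg : Lg K K' η s t n l μ = toOp2 (Mg K K' η s t k μ)⁻¹ * Lsite K K' η μ *
      toOp2 (Mg K K' η s t (k - 1) μ) := rfl
  rw [eg, eL, Matrix.inv_def]
  generalize Ring.inverse (Mg K K' η s t k μ).det = r
  rw [Mg, Mg, Matrix.adjugate_fin_two_of]
  generalize (gJ K K' (τJ K η s t k))⁻¹ = g₁
  generalize (gJ K K' (τJ K η s t (k - 1)))⁻¹ = g₂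
  rw [hk1]
  have nH := auxJ_nH K K'
  have nT := auxJ_nT K K'
  constructor
  · have h1 := auxJ_A K K' hτ (2 * η) (μ - η) (s + 2 * ((k : ℂ) - 1) * η - μ) (μ + η)
      (s + 2 * (k : ℂ) * η - μ) (s + 2 * ((k : ℂ) - 1) * η - η)
      (s + (2 * (k : ℂ) - 1) * η) (by ring) (by ring) (by ring) (by ring)
    have h2 := auxJ_B K K' hτ (2 * η) (μ - η) (s + 2 * ((k : ℂ) - 1) * η - μ) (μ + η)
      (s + 2 * (k : ℂ) * η - μ) (s + 2 * ((k : ℂ) - 1) * η - η)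
      (s + (2 * (k : ℂ) - 1) * η) (by ring) (by ring) (by ring) (by ring)
    have h3 := auxJ_B K K' hτ (μ - η) (2 * η) (s + 2 * ((k : ℂ) - 1) * η - μ) (μ + η)
      (s + 2 * ((k : ℂ) - 1) * η - η) (s + 2 * (k : ℂ) * η - μ)
      (s + (2 * (k : ℂ) - 1) * η) (by ring) (by ring) (by ring) (by ring)
    have h4 := auxJ_C K K' hτ (2 * η) (μ - η) (s + 2 * ((k : ℂ) - 1) * η - μ) (μ + η)
      (s + 2 * (k : ℂ) * η - μ) (s + 2 * ((k : ℂ) - 1) * η - η)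
      (s + (2 * (k : ℂ) - 1) * η) (by ring) (by ring) (by ring) (by ring)
    ext i
    fin_cases i <;>
    simp [toOp2, ωvec, Matrix.mul_apply, Matrix.mulVec, dotProduct, Fin.sum_univ_two, w4p3, w4m3,
      w1p2, w1m2]
    · linear_combination (-r * ΘJ K K' (s + 2 * (k : ℂ) * η - μ) * HJ K K' (μ + η)) * h1 +
        (r * HJ K K' (s + 2 * (k : ℂ) * η - μ) * ΘJ K K' (μ + η)) * h2
    · linear_combination (-r * ΘJ K K' (s + 2 * (k : ℂ) * η - μ) * ΘJ K K' (μ + η)) * h3 +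
        (r * HJ K K' (s + 2 * (k : ℂ) * η - μ) * HJ K K' (μ + η)) * h4
  · have h1 := auxJ_B K K' hτ (-(2 * η)) (μ + η) (t + (2 * (k : ℂ) - 1) * η) (μ - η)
      (t + (2 * (k : ℂ) - 1) * η - 2 * η) (t + 2 * (k : ℂ) * η + μ)
      (t + 2 * ((k : ℂ) - 1) * η + μ) (by ring) (by ring) (by ring) (by ring)
    have h2 := auxJ_C K K' hτ (-(2 * η)) (μ + η) (t + (2 * (k : ℂ) - 1) * η) (μ - η)
      (t + (2 * (k : ℂ) - 1) * η - 2 * η) (t + 2 * (k : ℂ) * η + μ)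
      (t + 2 * ((k : ℂ) - 1) * η + μ) (by ring) (by ring) (by ring) (by ring)
    have h3 := auxJ_A K K' hτ (-(2 * η)) (μ + η) (t + (2 * (k : ℂ) - 1) * η) (μ - η)
      (t + (2 * (k : ℂ) - 1) * η - 2 * η) (t + 2 * (k : ℂ) * η + μ)
      (t + 2 * ((k : ℂ) - 1) * η + μ) (by ring) (by ring) (by ring) (by ring)
    have h4 := auxJ_B K K' hτ (μ + η) (-(2 * η)) (t + (2 * (k : ℂ) - 1) * η) (μ - η)
      (t + 2 * (k : ℂ) * η + μ) (t + (2 * (k : ℂ) - 1) * η - 2 * η)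
      (t + 2 * ((k : ℂ) - 1) * η + μ) (by ring) (by ring) (by ring) (by ring)
    rw [nH, nT] at h1 h2 h3 h4
    ext i
    fin_cases i <;>
    simp [toOp2, ωdual, Matrix.mul_apply, Matrix.vecMul, dotProduct, Fin.sum_univ_two, w4p3, w4m3,
      w1p2, w1m2]
    · linear_combination
        (r * g₁ * g₂ * ΘJ K K' (t + 2 * (k : ℂ) * η + μ) * ΘJ K K' (μ - η)) * h1 -
        (r * g₁ * g₂ * HJ K K' (t + 2 * (k : ℂ) * η + μ) * HJ K K' (μ - η)) * h2
    · linear_combination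
        (-r * g₁ * g₂ * ΘJ K K' (t + 2 * (k : ℂ) * η + μ) * HJ K K' (μ - η)) * h3 +
        (r * g₁ * g₂ * HJ K K' (t + 2 * (k : ℂ) * η + μ) * ΘJ K K' (μ - η)) * h4

end
end
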